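/- Let E be a Riesz space with point separating order dual, let I be a closed algebra ideal in Z(E), and let A = Z(E)/I with the quotient norm. Then A is a normed algebra, and A'' with the Arens product may be identified (as an algebra) with the subalgebra (I^{00})^d = {F ∈ Z(E)'' : |F| ∧ |G| = 0 for all G ∈ I^{00}} of Z(E)'', the disjoint complement of the bipolar I^{00} of I in Z(E)''. -/

import Mathlib

noncomputable section

open Set

/-- A map between preordered sets is *order bounded* if it maps order intervals into
order intervals. -/
def IsOrdBdd {E F : Type*} [Preorder E] [Preorder F] (f : E → F) : Prop :=
  ∀ a b : E, ∃ c d : F, ∀ x : E, a ≤ x → x ≤ b → c ≤ f x ∧ f x ≤ d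

/-- A map of a Riesz space is *band preserving* if it preserves disjointness. -/
def IsBandPres {E : Type*} [Lattice E] [AddCommGroup E] (T : E → E) : Prop :=
  ∀ x y : E, |x| ⊓ |y| = 0 → |T x| ⊓ |y| = 0

/-- An *orthomorphism*: an order bounded, band preserving linear map. -/
def IsOrtho {E : Type*} [Lattice E] [AddCommGroup E] [Module ℝ E] (T : E → E) : Prop :=
  IsLinearMap ℝ T ∧ IsOrdBdd T ∧ IsBandPres T

/-- A member of the *ideal center* `Z(E)`: an orthomorphism dominated by a multiple of the
identity. -/
def IsCentral {E : Type*} [Lattice E] [AddCommGroup E] [Module ℝ E] (T : E → E) : Prop :=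
  IsOrtho T ∧ ∃ c : ℝ, ∀ x : E, 0 ≤ x → -(c • x) ≤ T x ∧ T x ≤ c • x

/-- Order continuity of a real functional: it converges to `0` along every downward
directed system with infimum `0`. -/
def IsOrderContinuousFun {X : Type*} [Lattice X] [AddCommGroup X] (φ : X → ℝ) : Prop :=
  ∀ s : Set X, s.Nonempty → DirectedOn (· ≥ ·) s → IsGLB s 0 →
    ∀ ε : ℝ, 0 < ε → ∃ x ∈ s, ∀ y ∈ s, y ≤ x → |φ y| < ε

/-- `p` realizes the Riesz space `D` as the order dual `E^∼` of `E`. -/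
structure IsOrderDual (E D : Type*) [Lattice E] [AddCommGroup E] [Module ℝ E]
    [Lattice D] [AddCommGroup D] [Module ℝ D] (p : D → E → ℝ) : Prop where
  lin_fun : ∀ f : D, IsLinearMap ℝ (p f)
  lin_vec : ∀ x : E, IsLinearMap ℝ fun f => p f x
  bdd : ∀ f : D, IsOrdBdd (p f)
  inj : ∀ f g : D, (∀ x, p f x = p g x) → f = g
  surj : ∀ φ : E → ℝ, IsLinearMap ℝ φ → IsOrdBdd φ → ∃ f : D, ∀ x, p f x = φ x
  le_iff : ∀ f g : D, f ≤ g ↔ ∀ x : E, 0 ≤ x → p f x ≤ p g x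

/-- `p` realizes the Riesz space `B` as the order continuous order dual `(X^∼)ₙ` of `X`
(used for `X = A^∼`, giving `B = (A^∼)ₙ^∼`). -/
structure IsOrderContinuousDual (X B : Type*) [Lattice X] [AddCommGroup X] [Module ℝ X]
    [Lattice B] [AddCommGroup B] [Module ℝ B] (p : B → X → ℝ) : Prop where
  lin_fun : ∀ F : B, IsLinearMap ℝ (p F)
  lin_vec : ∀ f : X, IsLinearMap ℝ fun F => p F f
  bdd : ∀ F : B, IsOrdBdd (p F)
  cont : ∀ F : B, IsOrderContinuousFun (p F)
  inj : ∀ F G : B, (∀ f, p F f = p G f) → F = G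
  surj : ∀ φ : X → ℝ, IsLinearMap ℝ φ → IsOrdBdd φ → IsOrderContinuousFun φ →
    ∃ F : B, ∀ f, p F f = φ f
  le_iff : ∀ F G : B, F ≤ G ↔ ∀ f : X, 0 ≤ f → p F f ≤ p G f

/-- `ρ` realizes the lattice-ordered algebra `O` as the `f`-algebra `Orth(E)` of all
orthomorphisms of `E`. -/
structure IsOrthAlg (E O : Type*) [Lattice E] [AddCommGroup E] [Module ℝ E]
    [Lattice O] [Ring O] [Module ℝ O] (ρ : O → E → E) : Prop where
  ortho : ∀ a : O, IsOrtho (ρ a)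
  lin_vec : ∀ x : E, IsLinearMap ℝ fun a => ρ a x
  map_one : ∀ x : E, ρ 1 x = x
  map_mul : ∀ (a b : O) (x : E), ρ (a * b) x = ρ a (ρ b x)
  inj : ∀ a b : O, (∀ x, ρ a x = ρ b x) → a = b
  surj : ∀ T : E → E, IsOrtho T → ∃ a : O, ∀ x, ρ a x = T x
  le_iff : ∀ a b : O, a ≤ b ↔ ∀ x : E, 0 ≤ x → ρ a x ≤ ρ b x

/-- `ρ` realizes the normed lattice-ordered algebra `Z` as the ideal center `Z(E)` of `E`,
an AM-space whose norm is the order unit norm (the order/algebra unit being `id`). -/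
structure IsCenterOf (E Z : Type*) [Lattice E] [AddCommGroup E] [Module ℝ E]
    [Lattice Z] [NormedRing Z] [NormedAlgebra ℝ Z] (ρ : Z → E → E) : Prop where
  central : ∀ a : Z, IsCentral (ρ a)
  lin_vec : ∀ x : E, IsLinearMap ℝ fun a => ρ a x
  map_one : ∀ x : E, ρ 1 x = x
  map_mul : ∀ (a b : Z) (x : E), ρ (a * b) x = ρ a (ρ b x)
  inj : ∀ a b : Z, (∀ x, ρ a x = ρ b x) → a = b
  surj : ∀ T : E → E, IsCentral T → ∃ a : Z, ∀ x, ρ a x = T x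
  le_iff : ∀ a b : Z, a ≤ b ↔ ∀ x : E, 0 ≤ x → ρ a x ≤ ρ b x
  norm_le_iff : ∀ (a : Z) (c : ℝ), 0 ≤ c →
    (‖a‖ ≤ c ↔ ∀ x : E, 0 ≤ x → -(c • x) ≤ ρ a x ∧ ρ a x ≤ c • x)

/-- The pairing `p : D → E → ℝ` separates the points of `E`. -/
def SepPoints {E D : Type*} [Zero E] (p : D → E → ℝ) : Prop :=
  ∀ x : E, (∀ f : D, p f x = 0) → x = 0

/-- `y` belongs to the `σ(E,D)`-closure of `s ⊆ E`, for the pairing `p : D → E → ℝ`. -/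
def InWeakClosure {E D : Type*} (p : D → E → ℝ) (s : Set E) (y : E) : Prop :=
  ∀ (fs : Finset D) (ε : ℝ), 0 < ε → ∃ z ∈ s, ∀ f ∈ fs, |p f z - p f y| < ε

/-- `E` has a *topologically full center*: for each `x ∈ E₊` the `σ(E,E^∼)`-closure of
`Z(E)x` contains the order ideal generated by `x`.  Here `p : D → E → ℝ` is the duality
with `E^∼` and `ρ : Z → E → E` is the action of the ideal center. -/
def TopFullCenter {E D Z : Type*} [Lattice E] [AddCommGroup E] [Module ℝ E]
    (p : D → E → ℝ) (ρ : Z → E → E) : Prop :=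
  ∀ x : E, 0 ≤ x → ∀ y : E, (∃ c : ℝ, 0 ≤ c ∧ |y| ≤ c • x) →
    InWeakClosure p {z | ∃ T : Z, ρ T x = z} y

/-- `FG` is the Arens product `F ⬝ G` in the order bidual `B` of the algebra `A`:
`(F⬝G)(f) = F(G⬝f)`, `(G⬝f)(a) = G(f⬝a)`, `(f⬝a)(b) = f(ab)`; `pA : DA → A → ℝ` is the
duality of `A` with `A^∼` and `pB : B → DA → ℝ` that of `(A^∼)ₙ^∼` with `A^∼`. -/
def IsArensProduct {A DA B : Type*} [Mul A] (pA : DA → A → ℝ) (pB : B → DA → ℝ)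
    (F G FG : B) : Prop :=
  ∀ f Gf : DA,
    (∀ (a : A) (fa : DA), (∀ b : A, pA fa b = pA f (a * b)) → pA Gf a = pB G fa) →
    pB FG f = pB F Gf

/-- The ring structure of `B` is the Arens multiplication inherited from `A`, with unit the
canonical image of `1 ∈ A`. -/
structure IsArensAlgebra {A DA B : Type*} [Monoid A] [Ring B]
    (pA : DA → A → ℝ) (pB : B → DA → ℝ) : Prop where
  mul_def : ∀ F G : B, IsArensProduct pA pB F G (F * G)
  one_def : ∀ f : DA, pB 1 f = pA f 1

section NormedArens

variable (Z : Type*) [NormedRing Z] [NormedAlgebra ℝ Z]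

/-- First step of the Arens construction: `f ⬝ a` for `f ∈ Z'`, `a ∈ Z`:
`(f⬝a)(b) = f(ab)`. -/
def arensDot (f : Z →L[ℝ] ℝ) (a : Z) : Z →L[ℝ] ℝ :=
  f.comp (ContinuousLinearMap.mul ℝ Z a)

/-- `a ↦ f ⬝ a` as a continuous linear map. -/
def arensDotL (f : Z →L[ℝ] ℝ) : Z →L[ℝ] Z →L[ℝ] ℝ :=
  (ContinuousLinearMap.compL ℝ Z Z ℝ f).comp (ContinuousLinearMap.mul ℝ Z)

/-- Second step of the Arens construction: `F ⬝ f` for `F ∈ Z''`, `f ∈ Z'`: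
`(F⬝f)(a) = F(f⬝a)`. -/
def arensFDot (F : (Z →L[ℝ] ℝ) →L[ℝ] ℝ) (f : Z →L[ℝ] ℝ) : Z →L[ℝ] ℝ :=
  F.comp (arensDotL Z f)

/-- `f ↦ f ⬝ ·` as a continuous linear map. -/
def arensDotLL : (Z →L[ℝ] ℝ) →L[ℝ] Z →L[ℝ] Z →L[ℝ] ℝ :=
  ((ContinuousLinearMap.compL ℝ Z (Z →L[ℝ] Z) (Z →L[ℝ] ℝ)).flip
      (ContinuousLinearMap.mul ℝ Z)).comp (ContinuousLinearMap.compL ℝ Z Z ℝ)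

/-- `f ↦ F ⬝ f` as a continuous linear map. -/
def arensFDotL (F : (Z →L[ℝ] ℝ) →L[ℝ] ℝ) : (Z →L[ℝ] ℝ) →L[ℝ] Z →L[ℝ] ℝ :=
  (ContinuousLinearMap.compL ℝ Z (Z →L[ℝ] ℝ) ℝ F).comp (arensDotLL Z)

/-- The *Arens product* on the norm bidual `Z''`: `(F⬝G)(f) = F(G⬝f)`. -/
def arensMul (F G : (Z →L[ℝ] ℝ) →L[ℝ] ℝ) : (Z →L[ℝ] ℝ) →L[ℝ] ℝ :=
  F.comp (arensFDotL Z G)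

/-- The canonical image of `1 ∈ Z` in the bidual `Z''`; it is the unit for the Arens
product. -/
def arensOne : (Z →L[ℝ] ℝ) →L[ℝ] ℝ := ContinuousLinearMap.apply ℝ ℝ (1 : Z)

end NormedArens

section DualOrder

variable {Z : Type*} [Lattice Z] [NormedRing Z] [NormedAlgebra ℝ Z]

/-- Positivity of a functional in `Z'`. -/
def dualNonneg (μ : Z →L[ℝ] ℝ) : Prop := ∀ a : Z, 0 ≤ a → 0 ≤ μ a

/-- The canonical order of the bidual `Z''`. -/
def bidualLe (F G : (Z →L[ℝ] ℝ) →L[ℝ] ℝ) : Prop :=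
  ∀ μ : Z →L[ℝ] ℝ, dualNonneg μ → F μ ≤ G μ

/-- `H = F ⊔ G` in the bidual `Z''`. -/
def IsBidualSup (F G H : (Z →L[ℝ] ℝ) →L[ℝ] ℝ) : Prop :=
  bidualLe F H ∧ bidualLe G H ∧
    ∀ K : (Z →L[ℝ] ℝ) →L[ℝ] ℝ, bidualLe F K → bidualLe G K → bidualLe H K

/-- `s ⊆ Z''` is downward directed with infimum `0`. -/
def BidualDownTo0 (s : Set ((Z →L[ℝ] ℝ) →L[ℝ] ℝ)) : Prop :=
  s.Nonempty ∧ (∀ F ∈ s, ∀ G ∈ s, ∃ H ∈ s, bidualLe H F ∧ bidualLe H G) ∧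
    (∀ F ∈ s, bidualLe 0 F) ∧ ∀ K, (∀ F ∈ s, bidualLe K F) → bidualLe K 0

/-- The Riesz–Kantorovich formula for `|μ|(a)`, `μ ∈ Z'`, `a ∈ Z₊`. -/
def dualAbs (μ : Z →L[ℝ] ℝ) (a : Z) : ℝ := sSup ((fun b => μ b) '' {b : Z | |b| ≤ a})

/-- Disjointness `|μ| ⊓ |ν| = 0` in `Z'`. -/
def DualDisjoint (μ ν : Z →L[ℝ] ℝ) : Prop :=
  ∀ a : Z, 0 ≤ a → ∀ ε : ℝ, 0 < ε →
    ∃ b c : Z, 0 ≤ b ∧ 0 ≤ c ∧ b + c = a ∧ dualAbs μ b + dualAbs ν c < ε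

/-- The Riesz–Kantorovich formula for `|F|(μ)`, `F ∈ Z''`, `μ ∈ Z'₊`. -/
def bidualAbs (F : (Z →L[ℝ] ℝ) →L[ℝ] ℝ) (μ : Z →L[ℝ] ℝ) : ℝ :=
  sSup ((fun ν => F ν) '' {ν : Z →L[ℝ] ℝ | ∀ a : Z, 0 ≤ a → dualAbs ν a ≤ μ a})

/-- Disjointness `|F| ⊓ |G| = 0` in `Z''`. -/
def BidualDisjoint (F G : (Z →L[ℝ] ℝ) →L[ℝ] ℝ) : Prop :=
  ∀ μ : Z →L[ℝ] ℝ, dualNonneg μ → ∀ ε : ℝ, 0 < ε →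
    ∃ μ₁ μ₂ : Z →L[ℝ] ℝ, dualNonneg μ₁ ∧ dualNonneg μ₂ ∧ μ₁ + μ₂ = μ ∧
      bidualAbs F μ₁ + bidualAbs G μ₂ < ε

end DualOrder

/-- A member of the ideal center `Z(J)` of an order ideal `J` of a Riesz space, encoded as a
map defined on the ambient space whose restriction to `J` is the actual operator. -/
def IsCentralOn {D : Type*} [Lattice D] [AddCommGroup D] [Module ℝ D]
    (J : Set D) (S : D → D) : Prop :=
  (∀ f ∈ J, S f ∈ J) ∧ (∀ f ∈ J, ∀ g ∈ J, S (f + g) = S f + S g) ∧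
    (∀ (c : ℝ), ∀ f ∈ J, S (c • f) = c • S f) ∧
    ∃ c : ℝ, ∀ f ∈ J, 0 ≤ f → -(c • f) ≤ S f ∧ S f ≤ c • f

end

/-- The norm is the order unit norm of the algebra unit. -/
def IsOrderUnitNorm (Z : Type*) [Lattice Z] [NormedRing Z] [NormedAlgebra ℝ Z] : Prop :=
  ∀ (a : Z) (c : ℝ), 0 ≤ c → (‖a‖ ≤ c ↔ -(c • (1 : Z)) ≤ a ∧ a ≤ c • (1 : Z))

section IdealCenter

variable {E Z : Type*} [Lattice E] [AddCommGroup E] [Module ℝ E]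
  [Lattice Z] [NormedCommRing Z] [NormedAlgebra ℝ Z] {ρ : Z → E → E}

theorem IsCenterOf.isOrderUnitNorm (hZ : IsCenterOf E Z ρ) : IsOrderUnitNorm Z := by
  intro a c hc
  have h1 : ∀ x, ρ (c • (1 : Z)) x = c • x := fun x => by
    rw [(hZ.lin_vec x).map_smul, hZ.map_one]
  have h2 : ∀ x, ρ (-(c • (1 : Z))) x = -(c • x) := fun x => by
    rw [(hZ.lin_vec x).map_neg, h1]
  rw [hZ.norm_le_iff a c hc, hZ.le_iff, hZ.le_iff]
  simp only [h1, h2]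
  exact ⟨fun h => ⟨fun x hx => (h x hx).1, fun x hx => (h x hx).2⟩,
    fun h x hx => ⟨h.1 x hx, h.2 x hx⟩⟩

theorem IsCenterOf.isOrderedRing [CovariantClass Z Z (· + ·) (· ≤ ·)]
    (hZ : IsCenterOf E Z ρ) : IsOrderedRing Z := by
  have h0 : ∀ x, ρ (0 : Z) x = 0 := fun x => (hZ.lin_vec x).map_zero
  have hnn : ∀ a : Z, 0 ≤ a ↔ ∀ x : E, 0 ≤ x → 0 ≤ ρ a x := fun a => by
    simp only [hZ.le_iff, h0]
  have : IsOrderedAddMonoid Z := ⟨fun _ _ h c => by gcongr, fun _ _ h c => by gcongr⟩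
  have : ZeroLEOneClass Z := ⟨(hnn 1).2 fun x hx => by rwa [hZ.map_one]⟩
  refine IsOrderedRing.of_mul_nonneg fun a b ha hb => (hnn _).2 fun x hx => ?_
  rw [hZ.map_mul]
  exact (hnn a).1 ha _ ((hnn b).1 hb x hx)

end IdealCenter

section OrderUnit

variable {Z : Type*} [Lattice Z] [NormedCommRing Z] [NormedAlgebra ℝ Z]
  [IsOrderedRing Z] [PosSMulMono ℝ Z]

omit [IsOrderedRing Z] [PosSMulMono ℝ Z] in
theorem IsOrderUnitNorm.le_norm_smul_one (hu : IsOrderUnitNorm Z) (a : Z) :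
    a ≤ ‖a‖ • (1 : Z) :=
  ((hu a ‖a‖ (norm_nonneg a)).1 le_rfl).2

theorem IsOrderUnitNorm.norm_le_of_nonneg (hu : IsOrderUnitNorm Z) {a : Z} {c : ℝ}
    (hc : 0 ≤ c) (ha : 0 ≤ a) (hac : a ≤ c • (1 : Z)) : ‖a‖ ≤ c :=
  (hu a c hc).2 ⟨(neg_nonpos.2 (smul_nonneg hc zero_le_one)).trans ha, hac⟩

theorem IsOrderUnitNorm.norm_le_one (hu : IsOrderUnitNorm Z) {a : Z}
    (ha : 0 ≤ a) (ha1 : a ≤ 1) : ‖a‖ ≤ 1 :=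
  hu.norm_le_of_nonneg zero_le_one ha (by rwa [one_smul])

theorem IsOrderUnitNorm.norm_abs_le (hu : IsOrderUnitNorm Z) (a : Z) : ‖|a|‖ ≤ ‖a‖ := by
  have h := (hu a ‖a‖ (norm_nonneg a)).1 le_rfl
  exact hu.norm_le_of_nonneg (norm_nonneg a) (abs_nonneg a) (abs_le'.2 ⟨h.2, neg_le.1 h.1⟩)

omit [PosSMulMono ℝ Z] in
theorem IsOrderUnitNorm.norm_le_of_abs_le (hu : IsOrderUnitNorm Z) {a b : Z}
    (hab : |a| ≤ b) : ‖a‖ ≤ ‖b‖ := by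
  have h := hab.trans (hu.le_norm_smul_one b)
  exact (hu a ‖b‖ (norm_nonneg b)).2
    ⟨neg_le.1 ((neg_le_abs a).trans h), (le_abs_self a).trans h⟩

/-- In a lattice-ordered algebra whose unit is a strong order unit, disjoint elements have
product zero. -/
theorem IsOrderUnitNorm.mul_eq_zero_of_inf_eq_zero (hu : IsOrderUnitNorm Z) {u v : Z}
    (h : u ⊓ v = 0) : u * v = 0 := by
  have hu0 : 0 ≤ u := h ▸ inf_le_left
  have hv0 : 0 ≤ v := h ▸ inf_le_right
  obtain ⟨c, hc, huc, hvc⟩ : ∃ c : ℝ, 0 < c ∧ u ≤ c • (1 : Z) ∧ v ≤ c • (1 : Z) :=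
    ⟨‖u‖ + ‖v‖ + 1, by positivity,
      ((hu u _ (by positivity)).1 (by linarith [norm_nonneg v])).2,
      ((hu v _ (by positivity)).1 (by linarith [norm_nonneg u])).2⟩
  have h1 : c⁻¹ • (u * v) ≤ v := by
    have := smul_le_smul_of_nonneg_left (mul_le_mul_of_nonneg_right huc hv0) (inv_nonneg.2 hc.le)
    rwa [smul_mul_assoc, one_mul, smul_smul, inv_mul_cancel₀ hc.ne', one_smul] at this
  have h2 : c⁻¹ • (u * v) ≤ u := by
    have := smul_le_smul_of_nonneg_left (mul_le_mul_of_nonneg_left hvc hu0) (inv_nonneg.2 hc.le)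
    rwa [mul_smul_comm, mul_one, smul_smul, inv_mul_cancel₀ hc.ne', one_smul] at this
  have h3 : c⁻¹ • (u * v) = 0 :=
    le_antisymm (h ▸ le_inf h2 h1) (smul_nonneg (inv_nonneg.2 hc.le) (mul_nonneg hu0 hv0))
  exact (smul_eq_zero.1 h3).resolve_left (inv_ne_zero hc.ne')

theorem IsOrderUnitNorm.sq_nonneg (hu : IsOrderUnitNorm Z) (a : Z) : 0 ≤ a ^ 2 := by
  have h : a⁺ * a⁻ = 0 := hu.mul_eq_zero_of_inf_eq_zero (posPart_inf_negPart_eq_zero a)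
  have h2 : a ^ 2 = a⁺ ^ 2 + a⁻ ^ 2 := by
    nth_rewrite 1 [← posPart_sub_negPart a]
    linear_combination (-2) * h
  rw [h2]
  exact add_nonneg (pow_nonneg (posPart_nonneg a) 2) (pow_nonneg (negPart_nonneg a) 2)

theorem IsOrderUnitNorm.le_smul_one_of_sq_le (hu : IsOrderUnitNorm Z) {a : Z} {δ : ℝ}
    (hδ : 0 < δ) (h : a ^ 2 ≤ (δ ^ 2) • (1 : Z)) : a ≤ δ • (1 : Z) := by
  have h1 := hu.sq_nonneg (a - δ • (1 : Z))
  have h2 : (a - δ • (1 : Z)) ^ 2 = a ^ 2 - (2 * δ) • a + (δ ^ 2) • (1 : Z) := by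
    simp only [Algebra.smul_def, map_mul, map_pow, map_ofNat]; ring
  have h3 : (2 * δ) • a ≤ (2 * δ) • (δ • (1 : Z)) := by
    have h4 : (2 * δ) • (δ • (1 : Z)) = (δ ^ 2) • (1 : Z) + (δ ^ 2) • (1 : Z) := by
      rw [smul_smul, ← add_smul]; congr 1; ring
    rw [h4]
    rw [h2] at h1
    have h5 : (2 * δ) • a ≤ a ^ 2 + (δ ^ 2) • (1 : Z) := by
      rw [← sub_nonneg]; convert h1 using 1; abel
    exact h5.trans (by gcongr)
  have h6 := smul_le_smul_of_nonneg_left h3 (inv_nonneg.2 (by positivity : (0 : ℝ) ≤ 2 * δ))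
  rwa [inv_smul_smul₀ (by positivity), inv_smul_smul₀ (by positivity)] at h6

theorem IsOrderUnitNorm.norm_le_of_sq_le (hu : IsOrderUnitNorm Z) {a : Z} {δ : ℝ}
    (hδ : 0 < δ) (h : a ^ 2 ≤ (δ ^ 2) • (1 : Z)) : ‖a‖ ≤ δ :=
  (hu a δ hδ.le).2 ⟨neg_le.1 (hu.le_smul_one_of_sq_le hδ (by rwa [neg_sq])),
    hu.le_smul_one_of_sq_le hδ h⟩

theorem natCast_mul_mul_one_sub_pow_le_one {R : Type*} [CommRing R] [PartialOrder R]
    [IsOrderedRing R] {b : R} (hb : 0 ≤ b) (hb1 : b ≤ 1) (n : ℕ) :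
    n * (b * (1 - b) ^ n) ≤ 1 := by
  have h0 : 0 ≤ 1 - b := sub_nonneg.2 hb1
  have h1 : 1 - b ≤ 1 := sub_le_self 1 hb
  have hs : (∑ j ∈ Finset.range n, (1 - b) ^ j) * b = 1 - (1 - b) ^ n := by
    linear_combination (-1 : R) * geom_sum_mul (1 - b) n
  have hle : (n : R) * (1 - b) ^ n ≤ ∑ j ∈ Finset.range n, (1 - b) ^ j := by
    have := Finset.card_nsmul_le_sum (Finset.range n) (fun j => (1 - b) ^ j) ((1 - b) ^ n)
      fun j hj => pow_le_pow_of_le_one h0 h1 (Finset.mem_range.1 hj).le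
    simpa [nsmul_eq_mul] using this
  calc (n : R) * (b * (1 - b) ^ n) = n * (1 - b) ^ n * b := by ring
    _ ≤ (∑ j ∈ Finset.range n, (1 - b) ^ j) * b := mul_le_mul_of_nonneg_right hle hb
    _ = 1 - (1 - b) ^ n := hs
    _ ≤ 1 := sub_le_self 1 (pow_nonneg h0 n)

/-- An ideal contains local units `0 ≤ e ≤ 1`, up to an arbitrarily small error. -/
theorem IsOrderUnitNorm.exists_approx_unit (hu : IsOrderUnitNorm Z) (I : Ideal Z)
    (s : Finset I) {ε : ℝ} (hε : 0 < ε) :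
    ∃ e ∈ I, 0 ≤ e ∧ e ≤ 1 ∧ ∀ i ∈ s, ‖(i : Z) * e - i‖ ≤ ε := by
  set w : Z := ∑ i ∈ s, (i : Z) ^ 2 with hw
  have hwI : w ∈ I := I.sum_mem fun i _ => I.pow_mem_of_mem i.2 2 two_pos
  have hw0 : 0 ≤ w := Finset.sum_nonneg fun i _ => hu.sq_nonneg _
  set r : ℝ := ‖w‖ + 1 with hr
  have hr0 : 0 < r := by positivity
  set b : Z := r⁻¹ • w with hb
  have hbI : b ∈ I := by
    rw [hb, Algebra.smul_def]; exact I.mul_mem_left _ hwI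
  have hb0 : 0 ≤ b := smul_nonneg (inv_nonneg.2 hr0.le) hw0
  have hb1 : b ≤ 1 := by
    have := smul_le_smul_of_nonneg_left ((hu w r hr0.le).1 (by linarith)).2
      (inv_nonneg.2 hr0.le)
    rwa [inv_smul_smul₀ hr0.ne'] at this
  have h0 : 0 ≤ 1 - b := sub_nonneg.2 hb1
  have h1 : 1 - b ≤ 1 := sub_le_self 1 hb0
  obtain ⟨n, hn⟩ := exists_nat_gt (r / ε ^ 2)
  have hn0 : (0 : ℝ) < n := lt_trans (by positivity) hn
  refine ⟨1 - (1 - b) ^ n, ?_, sub_nonneg.2 (pow_le_one₀ h0 h1),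
    sub_le_self 1 (pow_nonneg h0 n), fun i hi => hu.norm_le_of_sq_le hε ?_⟩
  · have : 1 - (1 - b) ^ n = (∑ j ∈ Finset.range n, (1 - b) ^ j) * b := by
      linear_combination geom_sum_mul (1 - b) n
    rw [this]; exact I.mul_mem_left _ hbI
  have hiw : (i : Z) ^ 2 ≤ w :=
    Finset.single_le_sum (f := fun i : I => (i : Z) ^ 2) (fun i _ => hu.sq_nonneg _) hi
  have hwb : w = r • b := by rw [hb, smul_inv_smul₀ hr0.ne']
  have hp := natCast_mul_mul_one_sub_pow_le_one hb0 hb1 n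
  have hp' : b * (1 - b) ^ n ≤ (n : ℝ)⁻¹ • (1 : Z) := by
    have := smul_le_smul_of_nonneg_left hp (inv_nonneg.2 hn0.le)
    rwa [← nsmul_eq_mul, ← Nat.cast_smul_eq_nsmul ℝ, inv_smul_smul₀ hn0.ne'] at this
  have hpn : 0 ≤ (1 - b) ^ n := pow_nonneg h0 n
  calc ((i : Z) * (1 - (1 - b) ^ n) - i) ^ 2
      = (i : Z) ^ 2 * (1 - b) ^ n * (1 - b) ^ n := by ring
    _ ≤ w * (1 - b) ^ n * 1 := by
        gcongr
        exact pow_le_one₀ h0 h1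
    _ = r • (b * (1 - b) ^ n) := by rw [hwb, mul_one, smul_mul_assoc]
    _ ≤ r • ((n : ℝ)⁻¹ • (1 : Z)) := smul_le_smul_of_nonneg_left hp' hr0.le
    _ = (r * (n : ℝ)⁻¹) • (1 : Z) := smul_smul _ _ _
    _ ≤ (ε ^ 2) • (1 : Z) := by
        have : r * (n : ℝ)⁻¹ ≤ ε ^ 2 := by
          rw [← div_eq_mul_inv, div_le_iff₀ hn0]
          rw [div_lt_iff₀ (by positivity)] at hn
          linarith
        rw [← sub_nonneg, ← sub_smul]
        exact smul_nonneg (sub_nonneg.2 this) zero_le_one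

end OrderUnit

section DualLattice

variable {Z : Type*} [Lattice Z] [NormedCommRing Z] [NormedAlgebra ℝ Z]
  [IsOrderedRing Z] [PosSMulMono ℝ Z]

omit [PosSMulMono ℝ Z] in
theorem dualNonneg.mono {μ : Z →L[ℝ] ℝ} (hμ : dualNonneg μ) {a b : Z} (h : a ≤ b) :
    μ a ≤ μ b := by
  have := hμ (b - a) (sub_nonneg.2 h)
  rwa [map_sub, sub_nonneg] at this

omit [PosSMulMono ℝ Z] in
theorem dualNonneg.abs_apply_le {μ : Z →L[ℝ] ℝ} (hμ : dualNonneg μ) (a : Z) :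
    |μ a| ≤ μ |a| :=
  abs_le'.2 ⟨hμ.mono (le_abs_self a), by rw [← map_neg]; exact hμ.mono (neg_le_abs a)⟩

omit [PosSMulMono ℝ Z] in
theorem dualAbs_le_of_abs_apply_le {μ ν : Z →L[ℝ] ℝ} (hμ : dualNonneg μ)
    (h : ∀ b, |ν b| ≤ μ |b|) (a : Z) (ha : 0 ≤ a) : dualAbs ν a ≤ μ a := by
  refine csSup_le ⟨ν 0, 0, by simpa using ha, rfl⟩ ?_
  rintro _ ⟨b, hb, rfl⟩
  exact (le_abs_self _).trans ((h b).trans (hμ.mono hb))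

omit [PosSMulMono ℝ Z] in
theorem IsOrderUnitNorm.le_dualAbs (hu : IsOrderUnitNorm Z) (ν : Z →L[ℝ] ℝ) {a b : Z}
    (hb : |b| ≤ a) : ν b ≤ dualAbs ν a := by
  refine le_csSup ⟨‖ν‖ * ‖a‖, ?_⟩ ⟨b, hb, rfl⟩
  rintro _ ⟨c, hc, rfl⟩
  calc ν c ≤ ‖ν c‖ := Real.le_norm_self _
    _ ≤ ‖ν‖ * ‖c‖ := ν.le_opNorm c
    _ ≤ ‖ν‖ * ‖a‖ := by gcongr; exact hu.norm_le_of_abs_le hc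

omit [PosSMulMono ℝ Z] in
theorem IsOrderUnitNorm.abs_apply_le_of_dualAbs_le (hu : IsOrderUnitNorm Z)
    {μ ν : Z →L[ℝ] ℝ} (h : ∀ a, 0 ≤ a → dualAbs ν a ≤ μ a) (b : Z) : |ν b| ≤ μ |b| := by
  refine abs_le'.2 ⟨(hu.le_dualAbs ν le_rfl).trans (h _ (abs_nonneg b)), ?_⟩
  rw [← map_neg]
  exact (hu.le_dualAbs ν (abs_neg b).le).trans (h _ (abs_nonneg b))

theorem IsOrderUnitNorm.opNorm_le_of_abs_apply_le (hu : IsOrderUnitNorm Z)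
    {μ ν : Z →L[ℝ] ℝ} (h : ∀ b, |ν b| ≤ μ |b|) : ‖ν‖ ≤ ‖μ‖ := by
  refine ν.opNorm_le_bound (norm_nonneg _) fun b => ?_
  calc ‖ν b‖ ≤ μ |b| := h b
    _ ≤ ‖μ |b|‖ := Real.le_norm_self _
    _ ≤ ‖μ‖ * ‖|b|‖ := μ.le_opNorm _
    _ ≤ ‖μ‖ * ‖b‖ := by gcongr; exact hu.norm_abs_le b

theorem IsOrderUnitNorm.le_bidualAbs (hu : IsOrderUnitNorm Z)
    (F : (Z →L[ℝ] ℝ) →L[ℝ] ℝ) {μ ν : Z →L[ℝ] ℝ} (hμ : dualNonneg μ)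
    (h : ∀ b, |ν b| ≤ μ |b|) : F ν ≤ bidualAbs F μ := by
  refine le_csSup ⟨‖F‖ * ‖μ‖, ?_⟩ ⟨ν, dualAbs_le_of_abs_apply_le hμ h, rfl⟩
  rintro _ ⟨κ, hκ, rfl⟩
  calc F κ ≤ ‖F κ‖ := Real.le_norm_self _
    _ ≤ ‖F‖ * ‖κ‖ := F.le_opNorm κ
    _ ≤ ‖F‖ * ‖μ‖ := by
      gcongr
      exact hu.opNorm_le_of_abs_apply_le (hu.abs_apply_le_of_dualAbs_le hκ)

theorem IsOrderUnitNorm.abs_apply_le_bidualAbs (hu : IsOrderUnitNorm Z)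
    (F : (Z →L[ℝ] ℝ) →L[ℝ] ℝ) {μ : Z →L[ℝ] ℝ} (hμ : dualNonneg μ) :
    |F μ| ≤ bidualAbs F μ := by
  refine abs_le'.2 ⟨hu.le_bidualAbs F hμ hμ.abs_apply_le, ?_⟩
  rw [← map_neg]
  exact hu.le_bidualAbs F hμ fun b => by simpa using hμ.abs_apply_le b

theorem IsOrderUnitNorm.bidualAbs_eq_zero (hu : IsOrderUnitNorm Z)
    {F : (Z →L[ℝ] ℝ) →L[ℝ] ℝ} {μ : Z →L[ℝ] ℝ} (hμ : dualNonneg μ)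
    (h : ∀ ν : Z →L[ℝ] ℝ, (∀ b, |ν b| ≤ μ |b|) → F ν = 0) : bidualAbs F μ = 0 := by
  refine le_antisymm (csSup_le ⟨F μ, μ,
    dualAbs_le_of_abs_apply_le hμ hμ.abs_apply_le, rfl⟩ ?_) ?_
  · rintro _ ⟨ν, hν, rfl⟩
    exact (h ν (hu.abs_apply_le_of_dualAbs_le hν)).le
  · exact (abs_nonneg _).trans (hu.abs_apply_le_bidualAbs F hμ)

omit [IsOrderedRing Z] in
theorem posPart_smul_of_pos {c : ℝ} (hc : 0 < c) (a : Z) : (c • a)⁺ = c • a⁺ := by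
  have key : ∀ {c : ℝ}, 0 < c → ∀ a : Z, (c • a)⁺ ≤ c • a⁺ := fun hc a =>
    sup_le (smul_le_smul_of_nonneg_left (le_posPart _) hc.le)
      (smul_nonneg hc.le (posPart_nonneg a))
  refine le_antisymm (key hc a) ?_
  have := smul_le_smul_of_nonneg_left (key (inv_pos.2 hc) (c • a)) hc.le
  rwa [inv_smul_smul₀ hc.ne', smul_inv_smul₀ hc.ne'] at this

theorem IsOrderUnitNorm.norm_posPart_le (hu : IsOrderUnitNorm Z) (a : Z) : ‖a⁺‖ ≤ ‖a‖ := by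
  refine (hu.norm_le_of_abs_le (b := |a|) ?_).trans (hu.norm_abs_le a)
  rw [abs_of_nonneg (posPart_nonneg a)]
  exact sup_le (le_abs_self a) (abs_nonneg a)

/-- Every continuous functional is a difference of positive ones. -/
theorem IsOrderUnitNorm.exists_dualNonneg_sub (hu : IsOrderUnitNorm Z) (μ : Z →L[ℝ] ℝ) :
    ∃ μ₁ μ₂ : Z →L[ℝ] ℝ, dualNonneg μ₁ ∧ dualNonneg μ₂ ∧ μ = μ₁ - μ₂ := by
  have hadd : ∀ a b : Z, ‖(a + b)⁺‖ ≤ ‖a⁺‖ + ‖b⁺‖ := fun a b => by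
    refine (hu.norm_le_of_abs_le ?_).trans (norm_add_le a⁺ b⁺)
    rw [abs_of_nonneg (posPart_nonneg _)]
    exact sup_le (add_le_add (le_posPart _) (le_posPart _))
      (add_nonneg (posPart_nonneg a) (posPart_nonneg b))
  obtain ⟨g, hg, hgN⟩ := exists_extension_of_le_sublinear
    (⟨LinearMap.ker (LinearMap.fst ℝ Z Z + LinearMap.snd ℝ Z Z),
      ((μ : Z →ₗ[ℝ] ℝ) ∘ₗ LinearMap.fst ℝ Z Z).domRestrict _⟩ : (Z × Z) →ₗ.[ℝ] ℝ)
    (fun p => ‖μ‖ * (‖p.1⁺‖ + ‖p.2⁺‖))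
    (fun c hc p => by
      simp only [Prod.smul_fst, Prod.smul_snd, posPart_smul_of_pos hc, norm_smul,
        Real.norm_of_nonneg hc.le]
      ring)
    (fun p r => by
      have h1 := hadd p.1 r.1
      have h2 := hadd p.2 r.2
      rw [← mul_add]
      refine mul_le_mul_of_nonneg_left ?_ (norm_nonneg _)
      simp only [Prod.fst_add, Prod.snd_add]
      linarith)
    (fun ⟨p, hp⟩ => by
      have hp2 : p.2 = -p.1 := by
        rw [eq_neg_iff_add_eq_zero, add_comm]; exact hp
      have h1 : ‖p.1‖ ≤ ‖p.1⁺‖ + ‖p.2⁺‖ := by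
        rw [hp2, posPart_neg]
        nth_rewrite 1 [← posPart_sub_negPart p.1]
        exact norm_sub_le _ _
      change μ p.1 ≤ _
      exact (Real.le_norm_self _).trans ((μ.le_opNorm _).trans
        (mul_le_mul_of_nonneg_left h1 (norm_nonneg _))))
  have key : ∀ φ : Z →ₗ[ℝ] ℝ, (∀ a, φ a ≤ ‖μ‖ * ‖a⁺‖) →
      ∃ ψ : Z →L[ℝ] ℝ, dualNonneg ψ ∧ ∀ a, ψ a = φ a := by
    intro φ hφ
    refine ⟨φ.mkContinuous ‖μ‖ fun a => abs_le'.2 ⟨(hφ a).trans ?_, ?_⟩,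
      fun a ha => ?_, fun a => rfl⟩
    · gcongr; exact hu.norm_posPart_le a
    · rw [← map_neg]
      refine (hφ (-a)).trans ?_
      gcongr
      simpa using hu.norm_posPart_le (-a)
    · have h := hφ (-a)
      rw [posPart_eq_zero.2 (neg_nonpos.2 ha), norm_zero, mul_zero, map_neg] at h
      exact neg_nonpos.1 h
  obtain ⟨μ₁, h1, e1⟩ := key (g ∘ₗ LinearMap.inl ℝ Z Z) fun a => by
    simpa using hgN (a, 0)
  obtain ⟨μ₂, h2, e2⟩ := key (g ∘ₗ LinearMap.inr ℝ Z Z) fun a => by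
    simpa using hgN (0, a)
  refine ⟨μ₁, μ₂, h1, h2, ContinuousLinearMap.ext fun a => ?_⟩
  have h3 : g (a, -a) = μ a := hg ⟨(a, -a), by simp⟩
  rw [sub_apply, e1, e2, ← h3]
  simp only [LinearMap.comp_apply, LinearMap.inl_apply, LinearMap.inr_apply, ← map_sub]
  simp

end DualLattice

section PolarProjection

open Filter Topology

variable {Z : Type*} [Lattice Z] [NormedCommRing Z] [NormedAlgebra ℝ Z]

/-- `Q` behaves like the band projection of `Z'` onto the disjoint complement of the polar
of the ideal `I`. -/
structure IsPolarProj (I : Ideal Z) (Q : (Z →L[ℝ] ℝ) →L[ℝ] Z →L[ℝ] ℝ) : Prop where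
  eq_zero : ∀ μ : Z →L[ℝ] ℝ, (∀ i ∈ I, μ i = 0) → Q μ = 0
  apply_mem : ∀ μ : Z →L[ℝ] ℝ, ∀ i ∈ I, Q μ i = μ i
  arensDot : ∀ (μ : Z →L[ℝ] ℝ) (a : Z), Q (arensDot Z μ a) = arensDot Z (Q μ) a
  norm_sub_le : ∀ μ : Z →L[ℝ] ℝ, ‖μ - Q μ‖ ≤ ‖μ‖
  nonneg : ∀ μ : Z →L[ℝ] ℝ, dualNonneg μ → dualNonneg (Q μ)
  sub_nonneg : ∀ μ : Z →L[ℝ] ℝ, dualNonneg μ → dualNonneg (μ - Q μ)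
  abs_le : ∀ μ ν : Z →L[ℝ] ℝ, dualNonneg μ → (∀ b, |ν b| ≤ μ |b|) →
    ∀ b, |Q ν b| ≤ Q μ |b|
  abs_sub_le : ∀ μ ν : Z →L[ℝ] ℝ, dualNonneg μ → (∀ b, |ν b| ≤ μ |b|) →
    ∀ b, |(ν - Q ν) b| ≤ (μ - Q μ) |b|

section Existence

variable [IsOrderedRing Z] [PosSMulMono ℝ Z]

omit [NormedAlgebra ℝ Z] [PosSMulMono ℝ Z] in
theorem abs_mul_le_of_nonneg_right (b : Z) {e : Z} (he : 0 ≤ e) : |b * e| ≤ |b| * e :=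
  abs_le'.2 ⟨mul_le_mul_of_nonneg_right (le_abs_self b) he, by
    rw [← neg_mul]; exact mul_le_mul_of_nonneg_right (neg_le_abs b) he⟩

theorem IsOrderUnitNorm.exists_isPolarProj (hu : IsOrderUnitNorm Z) (I : Ideal Z) :
    ∃ Q, IsPolarProj I Q := by
  classical
  choose e heI he0 he1 hes using fun k : Finset I × ℕ =>
    hu.exists_approx_unit I k.1 (Nat.one_div_pos_of_nat (α := ℝ) (n := k.2))
  let U : Ultrafilter (Finset I × ℕ) := Ultrafilter.of atTop
  have hlim : ∀ i ∈ I, Tendsto (fun k => i * e k) U (𝓝 i) := by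
    intro i hi
    refine Tendsto.mono_left ?_ (Ultrafilter.of_le atTop)
    rw [tendsto_iff_norm_sub_tendsto_zero]
    refine squeeze_zero' (Eventually.of_forall fun k => norm_nonneg _) ?_
      ((tendsto_one_div_add_atTop_nhds_zero_nat (𝕜 := ℝ)).comp
        (tendsto_snd.mono_left (prod_atTop_atTop_eq (α := Finset I) (β := ℕ)).ge))
    filter_upwards [eventually_ge_atTop (({⟨i, hi⟩} : Finset I), 0)] with k hk
    exact hes k ⟨i, hi⟩ (hk.1 (Finset.mem_singleton_self _))
  let ev : Finset I × ℕ → WeakDual ℝ (Z →L[ℝ] ℝ) := fun k =>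
    StrongDual.toWeakDual (ContinuousLinearMap.apply ℝ ℝ (e k))
  obtain ⟨J, -, hJ⟩ := (WeakDual.isCompact_closedBall (𝕜 := ℝ)
    (0 : (Z →L[ℝ] ℝ) →L[ℝ] ℝ) 1).ultrafilter_le_nhds (U.map ev) (by
      rw [le_principal_iff, Ultrafilter.mem_coe, Ultrafilter.mem_map]
      refine Filter.univ_mem' fun k => ?_
      suffices h : ‖(ContinuousLinearMap.apply ℝ ℝ (e k) : (Z →L[ℝ] ℝ) →L[ℝ] ℝ)‖ ≤ 1 from
        mem_closedBall_zero_iff.2 h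
      refine ContinuousLinearMap.opNorm_le_bound _ zero_le_one fun μ => ?_
      change ‖μ (e k)‖ ≤ _
      calc ‖μ (e k)‖ ≤ ‖μ‖ * ‖e k‖ := μ.le_opNorm _
        _ ≤ ‖μ‖ * 1 := by gcongr; exact hu.norm_le_one (he0 k) (he1 k)
        _ = 1 * ‖μ‖ := mul_comm _ _)
  have hJ' : ∀ μ : Z →L[ℝ] ℝ, Tendsto (fun k => μ (e k)) U (𝓝 (J μ)) := fun μ =>
    (tendsto_iff_forall_eval_tendsto_topDualPairing (f := ev)
      (l := (U : Filter (Finset I × ℕ)))).1 hJ μ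
  let Q := arensFDotL Z (WeakDual.toStrongDual J)
  have hQ : ∀ (μ : Z →L[ℝ] ℝ) (a : Z), Tendsto (fun k => μ (a * e k)) U (𝓝 (Q μ a)) :=
    fun μ a => hJ' (arensDot Z μ a)
  have hP : ∀ (μ : Z →L[ℝ] ℝ) (a : Z),
      Tendsto (fun k => μ (a * (1 - e k))) U (𝓝 ((μ - Q μ) a)) := fun μ a => by
    simp only [mul_sub, mul_one, map_sub]
    exact tendsto_const_nhds.sub (hQ μ a)
  have h1e : ∀ k, 0 ≤ 1 - e k := fun k => _root_.sub_nonneg.2 (he1 k)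
  refine ⟨Q, fun μ hμ => ?_, fun μ i hi => ?_, fun μ a => ?_, fun μ => ?_,
    fun μ hμ a ha => ?_, fun μ hμ a ha => ?_, fun μ ν hμ h b => ?_, fun μ ν hμ h b => ?_⟩
  · ext a
    refine tendsto_nhds_unique (hQ μ a) ?_
    simp only [hμ _ (I.mul_mem_left a (heI _))]
    exact tendsto_const_nhds
  · exact tendsto_nhds_unique (hQ μ i) ((μ.continuous.tendsto i).comp (hlim i hi))
  · ext b
    refine tendsto_nhds_unique (hQ _ b) ?_
    have := hQ μ (a * b)
    simp only [mul_assoc] at this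
    exact this
  · refine ContinuousLinearMap.opNorm_le_bound _ (norm_nonneg _) fun a => ?_
    refine le_of_tendsto (hP μ a).norm (Eventually.of_forall fun k => ?_)
    calc ‖μ (a * (1 - e k))‖ ≤ ‖μ‖ * (‖a‖ * ‖1 - e k‖) :=
          (μ.le_opNorm _).trans (by gcongr; exact norm_mul_le _ _)
      _ ≤ ‖μ‖ * (‖a‖ * 1) := by
          gcongr; exact hu.norm_le_one (h1e k) (sub_le_self 1 (he0 k))
      _ = ‖μ‖ * ‖a‖ := by rw [mul_one]
  · exact ge_of_tendsto (hQ μ a) (Eventually.of_forall fun k => hμ _ (mul_nonneg ha (he0 k)))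
  · exact ge_of_tendsto (hP μ a) (Eventually.of_forall fun k => hμ _ (mul_nonneg ha (h1e k)))
  · exact le_of_tendsto_of_tendsto (hQ ν b).abs (hQ μ |b|) (Eventually.of_forall fun k =>
      (h _).trans (hμ.mono (abs_mul_le_of_nonneg_right b (he0 k))))
  · exact le_of_tendsto_of_tendsto (hP ν b).abs (hP μ |b|) (Eventually.of_forall fun k =>
      (h _).trans (hμ.mono (abs_mul_le_of_nonneg_right b (h1e k))))

end Existence

namespace IsPolarProj

variable {I : Ideal Z} {Q : (Z →L[ℝ] ℝ) →L[ℝ] Z →L[ℝ] ℝ}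

theorem sub_apply_mem (hQ : IsPolarProj I Q) (μ : Z →L[ℝ] ℝ) :
    ∀ i ∈ I, (μ - Q μ) i = 0 := fun i hi => by
  rw [sub_apply, hQ.apply_mem μ i hi, sub_self]

theorem idem (hQ : IsPolarProj I Q) (μ : Z →L[ℝ] ℝ) : Q (Q μ) = Q μ := by
  have h := hQ.eq_zero _ (hQ.sub_apply_mem μ)
  rw [map_sub, sub_eq_zero] at h
  exact h.symm

variable [IsOrderedRing Z] [PosSMulMono ℝ Z]

/-- The disjoint complement of the bipolar of `I` consists of the functionals vanishing on
the range of the projection. -/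
theorem forall_bidualDisjoint_iff (hQ : IsPolarProj I Q) (hu : IsOrderUnitNorm Z)
    (F : (Z →L[ℝ] ℝ) →L[ℝ] ℝ) :
    (∀ H : (Z →L[ℝ] ℝ) →L[ℝ] ℝ, (∀ μ : Z →L[ℝ] ℝ, (∀ i ∈ I, μ i = 0) → H μ = 0) →
      BidualDisjoint F H) ↔ ∀ μ, F (Q μ) = 0 := by
  constructor
  · intro hF
    have hpos : ∀ μ, dualNonneg μ → F (Q μ) = 0 := by
      intro μ hμ
      refine abs_eq_zero.1 (le_antisymm (le_of_forall_pos_lt_add fun ε hε => ?_)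
        (abs_nonneg _))
      obtain ⟨μ₁, μ₂, h1, h2, hadd, hlt⟩ := hF (F.comp Q)
        (fun ν hν => by rw [ContinuousLinearMap.comp_apply, hQ.eq_zero ν hν, map_zero])
        (Q μ) (hQ.nonneg μ hμ) ε hε
      have hμ₂ : Q μ₂ = μ₂ := by
        have hle : ∀ b, |μ₂ b| ≤ Q μ |b| := fun b => by
          refine (h2.abs_apply_le b).trans ?_
          rw [← hadd, add_apply]
          exact le_add_of_nonneg_left (h1 _ (abs_nonneg b))
        ext b
        have := hQ.abs_sub_le _ _ (hQ.nonneg μ hμ) hle b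
        rw [hQ.idem, sub_self, zero_apply] at this
        have h0 := abs_eq_zero.1 (le_antisymm this (abs_nonneg _))
        rw [sub_apply, sub_eq_zero] at h0
        exact h0.symm
      have e1 := hu.abs_apply_le_bidualAbs F h1
      have e2 := hu.abs_apply_le_bidualAbs (F.comp Q) h2
      rw [ContinuousLinearMap.comp_apply, hμ₂] at e2
      rw [← hadd, map_add, zero_add]
      exact (abs_add_le _ _).trans_lt ((add_le_add e1 e2).trans_lt hlt)
    intro μ
    obtain ⟨μ₁, μ₂, h1, h2, rfl⟩ := hu.exists_dualNonneg_sub μ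
    rw [map_sub, map_sub, hpos μ₁ h1, hpos μ₂ h2, sub_zero]
  · intro hF H hH μ hμ ε hε
    refine ⟨Q μ, μ - Q μ, hQ.nonneg μ hμ, hQ.sub_nonneg μ hμ, add_sub_cancel _ _, ?_⟩
    have hFz : bidualAbs F (Q μ) = 0 := by
      refine hu.bidualAbs_eq_zero (hQ.nonneg μ hμ) fun ν hν => ?_
      have : ν = Q ν := by
        ext b
        have := hQ.abs_sub_le _ _ (hQ.nonneg μ hμ) hν b
        rw [hQ.idem, sub_self, zero_apply] at this
        have h0 := abs_eq_zero.1 (le_antisymm this (abs_nonneg _))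
        rwa [sub_apply, sub_eq_zero] at h0
      rw [this, hF]
    have hHz : bidualAbs H (μ - Q μ) = 0 := by
      refine hu.bidualAbs_eq_zero (hQ.sub_nonneg μ hμ) fun ν hν => ?_
      have : Q ν = 0 := by
        ext b
        have := hQ.abs_le _ _ (hQ.sub_nonneg μ hμ) hν b
        rw [map_sub, hQ.idem, sub_self, zero_apply] at this
        exact abs_eq_zero.1 (le_antisymm this (abs_nonneg _))
      have hν0 := hH _ (hQ.sub_apply_mem ν)
      rwa [this, sub_zero] at hν0
    rwa [hFz, hHz, add_zero]

omit [IsOrderedRing Z] [PosSMulMono ℝ Z] in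
theorem arensFDot_eq_zero (hQ : IsPolarProj I Q) {G : (Z →L[ℝ] ℝ) →L[ℝ] ℝ}
    (hG : ∀ μ, G (Q μ) = 0) (μ : Z →L[ℝ] ℝ) : arensFDotL Z G (Q μ) = 0 := by
  ext a
  change G (_root_.arensDot Z (Q μ) a) = 0
  rw [← hQ.arensDot, hG]

end IsPolarProj

end PolarProjection

section Quotient

variable {Z A : Type*} [NormedCommRing Z] [NormedAlgebra ℝ Z] [NormedRing A] [NormedAlgebra ℝ A]

/-- A functional vanishing on the kernel of a quotient map factors through it, with the same
bound. -/
theorem exists_factor_of_quotient_norm {I : Ideal Z} {q : Z →L[ℝ] A}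
    (hq_surj : Function.Surjective q) (hq_ker : ∀ z : Z, q z = 0 ↔ z ∈ I)
    (hq_norm : ∀ z : Z, ‖q z‖ = sInf {r : ℝ | ∃ i ∈ I, r = ‖z + i‖})
    (ν : Z →L[ℝ] ℝ) (hν : ∀ i ∈ I, ν i = 0) :
    ∃ g : A →L[ℝ] ℝ, g.comp q = ν ∧ ‖g‖ ≤ ‖ν‖ := by
  have hdep : ∀ z w, q z = q w → ν z = ν w := fun z w h => by
    rw [← sub_eq_zero, ← map_sub]
    exact hν _ ((hq_ker _).1 (by rw [map_sub, h, sub_self]))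
  have hs := Function.surjInv_eq hq_surj
  have hbound : ∀ z, ‖ν z‖ ≤ ‖ν‖ * ‖q z‖ := by
    intro z
    rw [hq_norm]
    rcases (norm_nonneg ν).eq_or_lt with h0 | h0
    · rw [norm_eq_zero.1 h0.symm]; simp
    rw [mul_comm, ← div_le_iff₀ h0]
    refine le_csInf ⟨_, 0, I.zero_mem, rfl⟩ ?_
    rintro _ ⟨i, hi, rfl⟩
    rw [div_le_iff₀ h0, mul_comm]
    have : ν z = ν (z + i) := by rw [map_add, hν i hi, add_zero]
    rw [this]
    exact ν.le_opNorm _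
  let gl : A →ₗ[ℝ] ℝ :=
    { toFun := fun x => ν (Function.surjInv hq_surj x)
      map_add' := fun x y => by
        rw [← map_add]; exact hdep _ _ (by rw [map_add, hs, hs, hs])
      map_smul' := fun c x => by
        rw [RingHom.id_apply, ← map_smul]; exact hdep _ _ (by rw [map_smul, hs, hs]) }
  refine ⟨gl.mkContinuous ‖ν‖ fun x => ?_, ?_, LinearMap.mkContinuous_norm_le _ (norm_nonneg _) _⟩
  · have := hbound (Function.surjInv hq_surj x)
    rwa [hs] at this
  · ext z
    exact hdep _ _ (hs _)

end Quotient

/-- Lemma 2.  Let `E` be a Riesz space with point separating order dual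
(realized as `D`), `Z` realizing the (commutative) ideal center `Z(E)`, `I` a closed
algebra ideal in `Z(E)`, and `A = Z(E)/I` with the quotient norm (realized by a normed
algebra `A` together with the quotient map `q`).  Then `A` is a normed algebra and the
bidual `A''` with the Arens product may be identified, as an algebra, with the subalgebra
`(I⁰⁰)ᵈ = {F ∈ Z(E)'' : |F| ⊓ |G| = 0 for all G ∈ I⁰⁰}` of `Z(E)''`: the disjoint
complement of the bipolar of `I` is closed under the operations of `Z(E)''` and there is
a canonical isometric linear bijection `Φ : A'' → (I⁰⁰)ᵈ` (satisfying `Φ(F)(g∘q) = F(g)`)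
which is multiplicative for the Arens products. -/
theorem statement10
    {E D Z A : Type*}
    [Lattice E] [AddCommGroup E] [Module ℝ E]
    [CovariantClass E E (· + ·) (· ≤ ·)] [PosSMulMono ℝ E]
    [Lattice D] [AddCommGroup D] [Module ℝ D]
    [CovariantClass D D (· + ·) (· ≤ ·)] [PosSMulMono ℝ D]
    [Lattice Z] [NormedCommRing Z] [NormedAlgebra ℝ Z]
    [CovariantClass Z Z (· + ·) (· ≤ ·)] [PosSMulMono ℝ Z]
    [NormedRing A] [NormedAlgebra ℝ A]
    (pE : D → E → ℝ) (hD : IsOrderDual E D pE) (hsep : SepPoints pE)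
    (ρ : Z → E → E) (hZ : IsCenterOf E Z ρ)
    -- `I` is a closed algebra ideal in `Z(E)`:
    (I : Ideal Z) (hIclosed : IsClosed (I : Set Z))
    -- `q : Z(E) → A` realizes `A` as the quotient algebra `Z(E)/I` with the quotient norm:
    (q : Z →L[ℝ] A) (hq_mul : ∀ a b : Z, q (a * b) = q a * q b) (hq_one : q 1 = 1)
    (hq_surj : Function.Surjective q) (hq_ker : ∀ z : Z, q z = 0 ↔ z ∈ I)
    (hq_norm : ∀ z : Z, ‖q z‖ = sInf {r : ℝ | ∃ i ∈ I, r = ‖z + i‖}) :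
    -- `(I⁰⁰)ᵈ` is a subalgebra of `Z(E)''`:
    (∀ F G : (Z →L[ℝ] ℝ) →L[ℝ] ℝ,
      (∀ H, (∀ μ : Z →L[ℝ] ℝ, (∀ i ∈ I, μ i = 0) → H μ = 0) → BidualDisjoint F H) →
      (∀ H, (∀ μ : Z →L[ℝ] ℝ, (∀ i ∈ I, μ i = 0) → H μ = 0) → BidualDisjoint G H) →
      ((∀ H, (∀ μ : Z →L[ℝ] ℝ, (∀ i ∈ I, μ i = 0) → H μ = 0) →
          BidualDisjoint (F + G) H) ∧
       (∀ c : ℝ, ∀ H, (∀ μ : Z →L[ℝ] ℝ, (∀ i ∈ I, μ i = 0) → H μ = 0) →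
          BidualDisjoint (c • F) H) ∧
       (∀ H, (∀ μ : Z →L[ℝ] ℝ, (∀ i ∈ I, μ i = 0) → H μ = 0) →
          BidualDisjoint (arensMul Z F G) H))) ∧
    -- the canonical identification `Φ : A'' ≅ (I⁰⁰)ᵈ ⊆ Z(E)''`:
    ∃ Φ : (((A →L[ℝ] ℝ) →L[ℝ] ℝ) → ((Z →L[ℝ] ℝ) →L[ℝ] ℝ)),
      IsLinearMap ℝ Φ ∧
      (∀ F, ‖Φ F‖ = ‖F‖) ∧
      (∀ (F : (A →L[ℝ] ℝ) →L[ℝ] ℝ) (g : A →L[ℝ] ℝ), Φ F (g.comp q) = F g) ∧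
      Set.range Φ =
        {F : (Z →L[ℝ] ℝ) →L[ℝ] ℝ |
          ∀ H, (∀ μ : Z →L[ℝ] ℝ, (∀ i ∈ I, μ i = 0) → H μ = 0) → BidualDisjoint F H} ∧
      (∀ F G : (A →L[ℝ] ℝ) →L[ℝ] ℝ, Φ (arensMul A F G) = arensMul Z (Φ F) (Φ G)) := by
  have hR : IsOrderedRing Z := hZ.isOrderedRing
  have hu : IsOrderUnitNorm Z := hZ.isOrderUnitNorm
  obtain ⟨Q, hQ⟩ := hu.exists_isPolarProj I
  have hiff := hQ.forall_bidualDisjoint_iff hu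
  refine ⟨fun F G hF hG => ?_, ?_⟩
  · rw [hiff] at hF hG
    simp only [hiff]
    refine ⟨fun μ => ?_, fun c μ => ?_, fun μ => ?_⟩
    · rw [add_apply, hF, hG, add_zero]
    · rw [smul_apply, hF, smul_zero]
    · change F (arensFDotL Z G (Q μ)) = 0
      rw [hQ.arensFDot_eq_zero hG, map_zero]
  have hinj : ∀ g h : A →L[ℝ] ℝ, g.comp q = h.comp q → g = h := fun g h hgh => by
    ext x
    obtain ⟨z, rfl⟩ := hq_surj x
    exact DFunLike.congr_fun hgh z
  choose L hL hLn using fun μ : Z →L[ℝ] ℝ =>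
    exists_factor_of_quotient_norm hq_surj hq_ker hq_norm (μ - Q μ) (hQ.sub_apply_mem μ)
  let Λ : (Z →L[ℝ] ℝ) →L[ℝ] A →L[ℝ] ℝ := LinearMap.mkContinuous
    { toFun := L
      map_add' := fun μ ν => hinj _ _ (by
        rw [ContinuousLinearMap.add_comp, hL, hL, hL, map_add]; abel)
      map_smul' := fun c μ => hinj _ _ (by
        rw [RingHom.id_apply, ContinuousLinearMap.smul_comp, hL, hL, map_smul, smul_sub]) }
    1 fun μ => by rw [one_mul]; exact (hLn μ).trans (hQ.norm_sub_le μ)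
  have hΛ : ∀ μ, (Λ μ).comp q = μ - Q μ := hL
  have hqI : ∀ (g : A →L[ℝ] ℝ), ∀ i ∈ I, g.comp q i = 0 := fun g i hi => by
    rw [ContinuousLinearMap.comp_apply, (hq_ker i).2 hi, map_zero]
  have hΛq : ∀ g : A →L[ℝ] ℝ, Λ (g.comp q) = g := fun g => hinj _ _ (by
    rw [hΛ, hQ.eq_zero _ (hqI g), sub_zero])
  have hΛQ : ∀ μ, Λ (Q μ) = 0 := fun μ => hinj _ _ (by
    rw [hΛ, hQ.idem, sub_self, ContinuousLinearMap.zero_comp])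
  have hqn : ‖q‖ ≤ 1 := q.opNorm_le_bound zero_le_one fun z => by
    rw [one_mul, hq_norm]
    refine csInf_le ⟨0, ?_⟩ ⟨0, I.zero_mem, by rw [add_zero]⟩
    rintro _ ⟨i, -, rfl⟩
    exact norm_nonneg _
  refine ⟨fun F => F.comp Λ, ⟨fun F G => rfl, fun c F => rfl⟩, fun F => le_antisymm ?_ ?_,
    fun F g => congrArg F (hΛq g), ?_, fun F G => ?_⟩
  · calc ‖F.comp Λ‖ ≤ ‖F‖ * ‖Λ‖ := F.opNorm_comp_le Λ
      _ ≤ ‖F‖ * 1 := by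
        gcongr; exact LinearMap.mkContinuous_norm_le _ zero_le_one _
      _ = ‖F‖ := mul_one _
  · refine F.opNorm_le_bound (norm_nonneg (F.comp Λ)) fun g => ?_
    calc ‖F g‖ = ‖F.comp Λ (g.comp q)‖ := by rw [ContinuousLinearMap.comp_apply, hΛq]
      _ ≤ ‖F.comp Λ‖ * (‖g‖ * ‖q‖) :=
        ((F.comp Λ).le_opNorm _).trans (by gcongr; exact g.opNorm_comp_le q)
      _ ≤ ‖F.comp Λ‖ * (‖g‖ * 1) := by gcongr
      _ = ‖F.comp Λ‖ * ‖g‖ := by rw [mul_one]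
  · ext F
    rw [Set.mem_ofPred_eq, hiff]
    constructor
    · rintro ⟨F, rfl⟩ μ
      rw [ContinuousLinearMap.comp_apply, hΛQ, map_zero]
    · intro hF
      refine ⟨F.comp ((ContinuousLinearMap.compL ℝ Z A ℝ).flip q), ?_⟩
      ext μ
      change F ((Λ μ).comp q) = F μ
      rw [hΛ, map_sub, hF, sub_zero]
  · have hG : ∀ μ, (G.comp Λ) (Q μ) = 0 := fun μ => by
      rw [ContinuousLinearMap.comp_apply, hΛQ, map_zero]
    ext μ
    change F (arensFDotL A G (Λ μ)) = F (Λ (arensFDotL Z (G.comp Λ) μ))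
    congr 1
    have hdot : ∀ (g : A →L[ℝ] ℝ) (a : Z),
        arensDot Z (g.comp q) a = (arensDot A g (q a)).comp q := fun g a => by
      ext b
      exact congrArg g (hq_mul a b)
    have key : arensFDotL Z (G.comp Λ) μ = (arensFDotL A G (Λ μ)).comp q := by
      have h1 : arensFDotL Z (G.comp Λ) μ = arensFDotL Z (G.comp Λ) ((Λ μ).comp q) := by
        rw [hΛ, map_sub, hQ.arensFDot_eq_zero hG, sub_zero]
      rw [h1]
      ext a
      change G (Λ (arensDot Z ((Λ μ).comp q) a)) = G (arensDot A (Λ μ) (q a))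
      rw [hdot, hΛq]
    rw [key, hΛq]
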